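/- Let G=(V,w,m,d) be a salami with connected salami partition P=(X,Y,K). If f ∈ ℱ(P) satisfies Δf(x) = 0 for all x ∈ K, then Δf(x) = 0 for all x ∈ V. In particular, ℋ(P) is non-empty, i.e. there exists a harmonic function in ℱ(P). -/

import Mathlib

open Filter

namespace SalamiPaper

variable {V : Type*}

/-- Locally finite: every vertex has finitely many neighbors. -/
def LocallyFinite (w : V → V → ℝ) : Prop := ∀ x : V, {y | 0 < w x y}.Finite

/-- Connectedness of the weighted graph: any two vertices are joined by a path. -/
def GraphConnected (w : V → V → ℝ) : Prop :=
  ∀ x y : V, Relation.ReflTransGen (fun a b => 0 < w a b) x y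

/-- The weighted graph Laplacian `Δf(x) = (1/m(x)) ∑_y w(x,y)(f(y)-f(x))`. -/
noncomputable def lap (w : V → V → ℝ) (m : V → ℝ) (f : V → ℝ) (x : V) : ℝ :=
  (m x)⁻¹ * ∑ᶠ y, w x y * (f y - f x)

/-- The vertex degree `Deg(x) = (1/m(x)) ∑_y w(x,y)`. -/
noncomputable def deg (w : V → V → ℝ) (m : V → ℝ) (x : V) : ℝ :=
  (m x)⁻¹ * ∑ᶠ y, w x y

/-- The set of `d`-lengths of adjacency paths from `x` to `y`. -/
def pathLens (w : V → V → ℝ) (d : V → V → ℝ) (x y : V) : Set ℝ :=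
  {L | ∃ (n : ℕ) (p : ℕ → V), p 0 = x ∧ p n = y ∧
    (∀ i < n, 0 < w (p i) (p (i + 1))) ∧
    L = ∑ i ∈ Finset.range n, d (p i) (p (i + 1))}

/-- `d` is a path metric on the graph with edge weight `w`. -/
def IsPathMetric (w : V → V → ℝ) (d : V → V → ℝ) : Prop :=
  (∀ x, d x x = 0) ∧ (∀ x y, x ≠ y → 0 < d x y) ∧ (∀ x y, d x y = d y x) ∧
  (∀ x y z, d x z ≤ d x y + d y z) ∧
  (∀ x y, d x y = sInf (pathLens w d x y))

/-- All balls are finite. -/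
def FiniteBalls (d : V → V → ℝ) : Prop := ∀ (x : V) (R : ℝ), {y | d x y ≤ R}.Finite

/-- The combinatorial graph distance (as a real number). -/
noncomputable def combDist (w : V → V → ℝ) (x y : V) : ℝ :=
  sInf {L | ∃ (n : ℕ) (p : ℕ → V), p 0 = x ∧ p n = y ∧
    (∀ i < n, 0 < w (p i) (p (i + 1))) ∧ L = (n : ℝ)}

/-- `Lip(1)`: the 1-Lipschitz functions with respect to `d`. -/
def Lip1 (d : V → V → ℝ) (f : V → ℝ) : Prop := ∀ x y, f y - f x ≤ d x y

/-- The Ollivier curvature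
`κ(x,y) = (1/d(x,y)) inf{Δf(x) - Δf(y) : f ∈ Lip(1), f(y)-f(x) = d(x,y)}`. -/
noncomputable def kappa (w : V → V → ℝ) (m : V → ℝ) (d : V → V → ℝ) (x y : V) : ℝ :=
  (d x y)⁻¹ * sInf {c | ∃ f : V → ℝ, Lip1 d f ∧ f y - f x = d x y ∧
    c = lap w m f x - lap w m f y}

/-- `m(A) = ∞`: the total measure of `A` is infinite. -/
def InfVolume (m : V → ℝ) (A : Set V) : Prop :=
  ∀ c : ℝ, ∃ F : Finset V, ↑F ⊆ A ∧ c < ∑ x ∈ F, m x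

/-- A salami partition `(X,Y,K)`. -/
def SalamiPartition (w : V → V → ℝ) (m : V → ℝ) (X Y K : Set V) : Prop :=
  X ∪ Y ∪ K = Set.univ ∧ Disjoint X Y ∧ Disjoint X K ∧ Disjoint Y K ∧
  K.Finite ∧ (∀ x ∈ X, ∀ y ∈ Y, w x y = 0) ∧ InfVolume m X ∧ InfVolume m Y

/-- Reachability inside a subset `A` of the vertex set. -/
def reachIn (w : V → V → ℝ) (A : Set V) : V → V → Prop :=
  Relation.ReflTransGen (fun a b => a ∈ A ∧ b ∈ A ∧ 0 < w a b)

/-- The induced subgraph on `A` is connected. -/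
def ConnectedIn (w : V → V → ℝ) (A : Set V) : Prop :=
  ∀ x ∈ A, ∀ y ∈ A, reachIn w A x y

/-- A connected salami partition: `K` induces a connected subgraph. -/
def ConnectedSalamiPartition (w : V → V → ℝ) (m : V → ℝ) (X Y K : Set V) : Prop :=
  SalamiPartition w m X Y K ∧ ConnectedIn w K

/-- The basic standing assumptions on a weighted graph `G = (V,w,m,d)`:
countable vertex set, symmetric non-negative edge weight vanishing on the diagonal,
positive vertex measure, local finiteness, connectedness,
`d` a path metric with finite balls. -/
def IsGraphBase (w : V → V → ℝ) (m : V → ℝ) (d : V → V → ℝ) : Prop :=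
  Countable V ∧ (∀ x y, w x y = w y x) ∧ (∀ x y, 0 ≤ w x y) ∧ (∀ x, w x x = 0) ∧
  (∀ x, 0 < m x) ∧ LocallyFinite w ∧ GraphConnected w ∧
  IsPathMetric w d ∧ FiniteBalls d

/-- Non-negative Ollivier curvature on all edges. -/
def NonnegCurv (w : V → V → ℝ) (m : V → ℝ) (d : V → V → ℝ) : Prop :=
  ∀ x y, 0 < w x y → 0 ≤ kappa w m d x y

/-- A salami: a connected, locally finite weighted graph with a path metric with
finite balls, non-negative Ollivier curvature, admitting a salami partition. -/
def IsSalami (w : V → V → ℝ) (m : V → ℝ) (d : V → V → ℝ) : Prop :=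
  IsGraphBase w m d ∧ NonnegCurv w m d ∧ ∃ X Y K : Set V, SalamiPartition w m X Y K

/-- `G` has at least `n` ends: there is a finite set `K` such that `V ∖ K` has at
least `n` infinite connected components. -/
def atLeastEnds (w : V → V → ℝ) (n : ℕ) : Prop :=
  ∃ K : Set V, K.Finite ∧ ∃ x : Fin n → V,
    (∀ i, x i ∉ K) ∧ (∀ i, {y | reachIn w Kᶜ (x i) y}.Infinite) ∧
    (∀ i j, i ≠ j → ¬ reachIn w Kᶜ (x i) (x j))

/-- `Lip(1,K)`: functions that are 1-Lipschitz on `K`. -/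
def Lip1On (d : V → V → ℝ) (K : Set V) (f : V → ℝ) : Prop :=
  ∀ x ∈ K, ∀ y ∈ K, f y - f x ≤ d x y

open Classical in
/-- The extremal Lipschitz extension operator `S(P)` of the salami partition
`P = (X,Y,K)`. -/
noncomputable def Sop (d : V → V → ℝ) (X Y K : Set V) (f : V → ℝ) : V → ℝ :=
  fun v =>
    if v ∈ K then f v
    else if v ∈ X then sSup {c | ∃ u ∈ K, c = f u - d v u}
    else sInf {c | ∃ u ∈ K, c = f u + d v u}

/-- `ℱ(P) = S(P)(Lip(1,K))`. -/
def calF (d : V → V → ℝ) (X Y K : Set V) : Set (V → ℝ) :=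
  {g | ∃ f : V → ℝ, Lip1On d K f ∧ g = Sop d X Y K f}

/-- `ℋ(P)`: the harmonic functions in `ℱ(P)`. -/
def calH (w : V → V → ℝ) (m : V → ℝ) (d : V → V → ℝ) (X Y K : Set V) :
    Set (V → ℝ) :=
  {g | g ∈ calF d X Y K ∧ ∀ x, lap w m g x = 0}

/-- `∇₊f(x) = max_{y∼x} (f(y)-f(x))/d(x,y)`. -/
noncomputable def gradPlus (w : V → V → ℝ) (d : V → V → ℝ) (f : V → ℝ) (x : V) : ℝ :=
  sSup {c | ∃ y, 0 < w x y ∧ c = (f y - f x) / d x y}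

/-- `∇₋f(x) = max_{y∼x} (f(x)-f(y))/d(x,y)`. -/
noncomputable def gradMinus (w : V → V → ℝ) (d : V → V → ℝ) (f : V → ℝ) (x : V) : ℝ :=
  sSup {c | ∃ y, 0 < w x y ∧ c = (f x - f y) / d x y}

/-- `|∇f|(x) = max_{y∼x} |f(y)-f(x)|/d(x,y)`. -/
noncomputable def gradAbs (w : V → V → ℝ) (d : V → V → ℝ) (f : V → ℝ) (x : V) : ℝ :=
  sSup {c | ∃ y, 0 < w x y ∧ c = |f y - f x| / d x y}

/-- Recurrence: for every `ε > 0` there is a finitely supported `f` with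
`‖f‖∞ = 1` and `-⟨f, Δf⟩ < ε`. -/
def Recurrent (w : V → V → ℝ) (m : V → ℝ) : Prop :=
  ∀ ε : ℝ, 0 < ε → ∃ f : V → ℝ, (Function.support f).Finite ∧
    (∀ x, |f x| ≤ 1) ∧ (∃ x, |f x| = 1) ∧
    -(∑ᶠ x, f x * lap w m f x * m x) < ε

open Classical in
/-- `∑_{x,y : f(y) < 0 ≤ f(x)} w(x,y)(f(x)-f(y))`. -/
noncomputable def cutSum (w : V → V → ℝ) (f : V → ℝ) : ℝ :=
  ∑ᶠ p : V × V, if f p.2 < 0 ∧ 0 ≤ f p.1 then w p.1 p.2 * (f p.1 - f p.2) else 0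

/-- Subexponential growth: `max_{B_r(x)} |u| = e^{o(r)}` as `r → ∞`. -/
def SubexpGrowth (d : V → V → ℝ) (x : V) (u : V → ℝ) : Prop :=
  Filter.Tendsto
    (fun r : ℕ => Real.log (sSup {c | ∃ y, d x y ≤ (r : ℝ) ∧ c = |u y|}) / (r : ℝ))
    Filter.atTop (nhds 0)


/-- The finite set of neighbors of a vertex. -/
noncomputable def LocallyFinite.nbrs {w : V → V → ℝ} (h : LocallyFinite w) (x : V) : Finset V :=
  (h x).toFinset

/-- Global characterisation of membership in `calF`: a 1-Lipschitz function which is minimal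
on `X` and maximal on `Y` with respect to its values on `K`. -/
structure IsExtremal (d : V → V → ℝ) (X Y K : Set V) (f : V → ℝ) : Prop where
  lip : Lip1 d f
  left : ∀ x ∈ X, ∃ k ∈ K, f k - f x = d x k
  right : ∀ y ∈ Y, ∃ k ∈ K, f y - f k = d k y

/-- Connectedness of the induced subgraph on `A` in terms of cuts. -/
def CutConnected (w : V → V → ℝ) (A : Set V) : Prop :=
  ∀ B ⊆ A, B.Nonempty → B ≠ A → ∃ a ∈ B, ∃ b ∈ A \ B, 0 < w a b

section Graph

variable {w : V → V → ℝ} {m : V → ℝ} {d : V → V → ℝ} {X Y K : Set V} {f g : V → ℝ}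

lemma lap_eq_sum (hw : ∀ x y, 0 ≤ w x y) (f : V → ℝ) {x : V} {T : Finset V}
    (hT : ∀ y, 0 < w x y → y ∈ T) :
    lap w m f x = (m x)⁻¹ * ∑ y ∈ T, w x y * (f y - f x) := by
  unfold lap
  rw [finsum_eq_sum_of_support_subset]
  intro y hy
  refine hT y ((hw x y).lt_of_ne fun h => hy ?_)
  simp [← h]

lemma lap_eq_sum_nbrs (hw : ∀ x y, 0 ≤ w x y) (h : LocallyFinite w) (f : V → ℝ) (x : V) :
    lap w m f x = (m x)⁻¹ * ∑ y ∈ h.nbrs x, w x y * (f y - f x) :=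
  lap_eq_sum hw f fun y hy => by simpa [LocallyFinite.nbrs] using hy

lemma lap_neg (f : V → ℝ) (x : V) : lap w m (-f) x = -lap w m f x := by
  unfold lap
  rw [← mul_neg, ← finsum_neg_distrib]
  congr 2
  funext y
  simp only [Pi.neg_apply]
  ring

lemma lap_sub_const (f : V → ℝ) (c : ℝ) (x : V) :
    lap w m (fun v => f v - c) x = lap w m f x := by
  simp [lap]

lemma Lip1.lap_le (hw : ∀ x y, 0 ≤ w x y) (h : LocallyFinite w) (hm : ∀ x, 0 < m x)
    (hf : Lip1 d f) (x : V) :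
    lap w m f x ≤ (m x)⁻¹ * ∑ y ∈ h.nbrs x, w x y * d x y := by
  rw [lap_eq_sum_nbrs hw h]
  have := (inv_pos.2 (hm x)).le
  gcongr with y
  · exact hw x y
  · exact hf x y

lemma Lip1.neg (hsym : ∀ x y, d x y = d y x) (hf : Lip1 d f) : Lip1 d (-f) := by
  intro x y
  have := hf y x
  rw [hsym x y]
  simp only [Pi.neg_apply]
  linarith

lemma lap_le_lap_of_adj (hG : IsGraphBase w m d) (hκ : NonnegCurv w m d) (hf : Lip1 d f)
    {x y : V} (hxy : 0 < w x y) (h : f y - f x = d x y) : lap w m f y ≤ lap w m f x := by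
  obtain ⟨-, -, hw, hw0, hm, hlf, -, ⟨-, hdpos, hdsym, -, -⟩, -⟩ := hG
  have hne : x ≠ y := by
    rintro rfl
    exact hxy.ne' (hw0 x)
  have hk := nonneg_of_mul_nonneg_right (hκ x y hxy) (inv_pos.2 (hdpos x y hne))
  have hle := hk.trans (csInf_le ?_ ⟨f, hf, h, rfl⟩)
  · linarith
  · refine ⟨-((m x)⁻¹ * ∑ z ∈ hlf.nbrs x, w x z * d x z) -
      (m y)⁻¹ * ∑ z ∈ hlf.nbrs y, w y z * d y z, ?_⟩
    rintro c ⟨u, hu, -, rfl⟩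
    have h1 := (hu.neg hdsym).lap_le hw hlf hm x
    have h2 := hu.lap_le hw hlf hm y
    rw [lap_neg] at h1
    linarith

lemma exists_adj_dist_add_le (hG : IsGraphBase w m d) {x y : V} (hxy : x ≠ y) :
    ∃ z, 0 < w x z ∧ d x z + d z y ≤ d x y := by
  obtain ⟨-, -, -, -, -, hlf, -, ⟨hd0, hdpos, -, htri, hinf⟩, -⟩ := hG
  have hpos := hdpos x y hxy
  have hlen : ∀ (p : ℕ → V) (n : ℕ), d (p 0) (p n) ≤
      ∑ i ∈ Finset.range n, d (p i) (p (i + 1)) := by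
    intro p n
    induction n with
    | zero => simp [hd0]
    | succ n ih =>
      rw [Finset.sum_range_succ]
      exact (htri _ (p n) _).trans (by gcongr)
  have hmem : ∀ L ∈ pathLens w d x y, ∃ z, 0 < w x z ∧ d x z + d z y ≤ L := by
    rintro L ⟨n, p, h0, hn, hadj, rfl⟩
    cases n with
    | zero => exact absurd (h0.symm.trans hn) hxy
    | succ n =>
      refine ⟨p 1, by simpa [h0] using hadj 0 (by omega), ?_⟩
      rw [Finset.sum_range_succ']
      have := hlen (fun i => p (i + 1)) n
      simp only [zero_add, h0, hn] at this ⊢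
      linarith
  have hne : (pathLens w d x y).Nonempty := by
    rw [Set.nonempty_iff_ne_empty]
    intro h
    rw [hinf, h, Real.sInf_empty] at hpos
    exact hpos.false
  obtain ⟨L, hL⟩ := hne
  obtain ⟨z₀, hz₀, -⟩ := hmem L hL
  obtain ⟨z, hz, hmin⟩ := Set.exists_min_image _ (fun z => d x z + d z y) (hlf x) ⟨z₀, hz₀⟩
  refine ⟨z, hz, ?_⟩
  conv_rhs => rw [hinf]
  refine le_csInf ⟨L, hL⟩ fun L₁ hL₁ => ?_
  obtain ⟨z₁, hz₁, hle⟩ := hmem L₁ hL₁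
  exact (hmin z₁ hz₁).trans hle

/-- Induction towards a target vertex `y` along the distance to `y`. -/
lemma dist_induction (hG : IsGraphBase w m d) (y : V) {P : V → Prop}
    (h : ∀ x, (∀ z, d z y < d x y → P z) → P x) (x : V) : P x := by
  obtain ⟨-, -, -, -, -, -, -, ⟨-, -, hdsym, -, -⟩, hball⟩ := hG
  by_contra hx
  have hfin : {z | d y z ≤ d y x ∧ ¬ P z}.Finite := (hball y (d y x)).subset fun z hz => hz.1
  obtain ⟨z, ⟨hz, hPz⟩, hmin⟩ := Set.exists_min_image _ (fun z => d z y) hfin ⟨x, le_rfl, hx⟩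
  refine hPz (h z fun u hu => ?_)
  by_contra hPu
  refine (hmin u ⟨?_, hPu⟩).not_gt hu
  rw [hdsym y u]
  exact (hu.le.trans_eq (hdsym z y)).trans hz

lemma lap_le_lap (hG : IsGraphBase w m d) (hκ : NonnegCurv w m d) (hf : Lip1 d f)
    (x y : V) : f y - f x = d x y → lap w m f y ≤ lap w m f x := by
  refine dist_induction hG y (P := fun x => f y - f x = d x y → lap w m f y ≤ lap w m f x)
    (fun x ih h => ?_) x
  by_cases hxy : x = y
  · rw [hxy]
  obtain ⟨z, hxz, hz⟩ := exists_adj_dist_add_le hG hxy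
  have h1 := hf x z
  have h2 := hf z y
  have hd : 0 < d x z := by
    refine hG.2.2.2.2.2.2.2.1.2.1 x z ?_
    rintro rfl
    exact hxz.ne' (hG.2.2.2.1 x)
  exact (ih z (by linarith) (by linarith)).trans
    (lap_le_lap_of_adj hG hκ hf hxz (by linarith))

lemma SalamiPartition.mem_cases (hP : SalamiPartition w m X Y K) (v : V) :
    v ∈ X ∨ v ∈ Y ∨ v ∈ K := by
  have : v ∈ X ∪ Y ∪ K := hP.1 ▸ Set.mem_univ v
  simpa [or_assoc] using this

lemma SalamiPartition.symm (hG : IsGraphBase w m d) (hP : SalamiPartition w m X Y K) :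
    SalamiPartition w m Y X K := by
  obtain ⟨hu, hXY, hXK, hYK, hK, hsep, hX, hY⟩ := hP
  refine ⟨by rwa [Set.union_comm Y X], hXY.symm, hYK, hXK, hK, fun y hy x hx => ?_, hY, hX⟩
  rw [hG.2.1]
  exact hsep x hx y hy

lemma InfVolume.nonempty (h : InfVolume m X) : X.Nonempty := by
  obtain ⟨F, hF, hlt⟩ := h 0
  obtain rfl | ⟨x, hx⟩ := F.eq_empty_or_nonempty
  · simp at hlt
  · exact ⟨x, hF hx⟩

lemma InfVolume.diff (hm : ∀ x, 0 < m x) (h : InfVolume m X) {A : Set V} (hA : A.Finite) :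
    InfVolume m (X \ A) := by
  classical
  intro c
  obtain ⟨F, hF, hlt⟩ := h (c + ∑ x ∈ hA.toFinset, m x)
  refine ⟨F \ hA.toFinset, ?_, ?_⟩
  · intro x hx
    simp only [Finset.coe_sdiff, Set.Finite.coe_toFinset, Set.mem_sdiff, Finset.mem_coe] at hx
    exact ⟨hF hx.1, hx.2⟩
  · have h1 : ∑ x ∈ F, m x ≤ ∑ x ∈ (F \ hA.toFinset) ∪ hA.toFinset, m x :=
      Finset.sum_le_sum_of_subset_of_nonneg (by simp) fun x _ _ => (hm x).le
    rw [Finset.sum_union Finset.sdiff_disjoint] at h1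
    linarith

/-- Every geodesic from `X` to `Y` passes through `K`. -/
lemma SalamiPartition.exists_dist_add_le (hG : IsGraphBase w m d)
    (hP : SalamiPartition w m X Y K) {x y : V} (hx : x ∈ X) (hy : y ∈ Y) :
    ∃ k ∈ K, d x k + d k y ≤ d x y := by
  revert hx
  refine dist_induction hG y (P := fun x => x ∈ X → ∃ k ∈ K, d x k + d k y ≤ d x y)
    (fun x ih hx => ?_) x
  have hxy : x ≠ y := by
    rintro rfl
    exact Set.disjoint_left.1 hP.2.1 hx hy
  obtain ⟨z, hxz, hz⟩ := exists_adj_dist_add_le hG hxy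
  have hd : 0 < d x z := by
    refine hG.2.2.2.2.2.2.2.1.2.1 x z ?_
    rintro rfl
    exact hxz.ne' (hG.2.2.2.1 x)
  rcases hP.mem_cases z with h | h | h
  · obtain ⟨k, hk, hle⟩ := ih z (by linarith) h
    have := hG.2.2.2.2.2.2.2.1.2.2.2.1 x z k
    exact ⟨k, hk, by linarith⟩
  · exact absurd (hP.2.2.2.2.2.1 x hx z h) hxz.ne'
  · exact ⟨z, h, hz⟩

lemma SalamiPartition.nonempty (hG : IsGraphBase w m d) (hP : SalamiPartition w m X Y K) :
    K.Nonempty := by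
  obtain ⟨x, hx⟩ := hP.2.2.2.2.2.2.1.nonempty
  obtain ⟨y, hy⟩ := hP.2.2.2.2.2.2.2.nonempty
  obtain ⟨k, hk, -⟩ := hP.exists_dist_add_le hG hx hy
  exact ⟨k, hk⟩

lemma ConnectedIn.cutConnected (h : ConnectedIn w K) : CutConnected w K := by
  rintro B hBK ⟨a, ha⟩ hne
  by_contra! hcon
  refine hne (hBK.antisymm fun b hb => ?_)
  have hreach := h a (hBK ha) b hb
  unfold reachIn at hreach
  induction hreach with
  | refl => exact ha
  | tail _ hbc ih =>
    by_contra hc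
    exact (hcon _ (ih hbc.1) _ ⟨hb, hc⟩).not_gt hbc.2.2

lemma CutConnected.insert (hsym : ∀ x y, w x y = w y x) (h : CutConnected w K) {u v : V}
    (hu : u ∈ K) (huv : 0 < w u v) : CutConnected w (insert v K) := by
  intro B hB hBne hne
  by_cases hvK : v ∈ K
  · rw [Set.insert_eq_of_mem hvK] at hB hne ⊢
    exact h B hB hBne hne
  by_cases h0 : (B ∩ K).Nonempty
  · by_cases h1 : B ∩ K = K
    · have hKB : K ⊆ B := Set.inter_eq_right.1 h1
      refine ⟨u, hKB hu, v, ⟨Set.mem_insert v K, fun hvB => hne (hB.antisymm ?_)⟩, huv⟩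
      exact Set.insert_subset hvB hKB
    · obtain ⟨a, ha, b, hb, hab⟩ := h (B ∩ K) Set.inter_subset_right h0 h1
      exact ⟨a, ha.1, b, ⟨Or.inr hb.1, fun hbB => hb.2 ⟨hbB, hb.1⟩⟩, hab⟩
  · rw [Set.not_nonempty_iff_eq_empty] at h0
    have hnot : ∀ b ∈ B, b ∉ K := fun b hb hbK => by
      have : b ∈ B ∩ K := ⟨hb, hbK⟩
      simp [h0] at this
    obtain ⟨b, hb⟩ := hBne
    obtain rfl : b = v := (hB hb).resolve_right (hnot b hb)
    exact ⟨b, hb, u, ⟨Or.inr hu, fun huB => hnot u huB hu⟩, by rwa [hsym]⟩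

lemma IsExtremal.neg (hdsym : ∀ x y, d x y = d y x) (hf : IsExtremal d X Y K f) :
    IsExtremal d Y X K (-f) := by
  refine ⟨hf.lip.neg hdsym, fun y hy => ?_, fun x hx => ?_⟩
  · obtain ⟨k, hk, h⟩ := hf.right y hy
    refine ⟨k, hk, ?_⟩
    rw [hdsym, ← h]
    simp only [Pi.neg_apply]
    ring
  · obtain ⟨k, hk, h⟩ := hf.left x hx
    refine ⟨k, hk, ?_⟩
    rw [hdsym, ← h]
    simp only [Pi.neg_apply]
    ring

lemma IsExtremal.sub_const (hf : IsExtremal d X Y K f) (c : ℝ) :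
    IsExtremal d X Y K fun v => f v - c :=
  ⟨fun x y => by simpa using hf.lip x y, by simpa using hf.left, by simpa using hf.right⟩

lemma IsExtremal.mono {X' K' : Set V} (hf : IsExtremal d X Y K f) (hX : X' ⊆ X) (hK : K ⊆ K') :
    IsExtremal d X' Y K' f := by
  refine ⟨hf.lip, fun x hx => ?_, fun y hy => ?_⟩
  · obtain ⟨k, hk, h⟩ := hf.left x (hX hx)
    exact ⟨k, hK hk, h⟩
  · obtain ⟨k, hk, h⟩ := hf.right y hy
    exact ⟨k, hK hk, h⟩

lemma IsExtremal.le_of_le_on (hP : SalamiPartition w m X Y K)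
    (hf : IsExtremal d X Y K f) (hg : IsExtremal d X Y K g) (h : ∀ k ∈ K, f k ≤ g k) (v : V) :
    f v ≤ g v := by
  rcases hP.mem_cases v with hv | hv | hv
  · obtain ⟨k, hk, hfk⟩ := hf.left v hv
    linarith [h k hk, hg.lip v k]
  · obtain ⟨k, hk, hgk⟩ := hg.right v hv
    linarith [h k hk, hf.lip k v]
  · exact h v hv

lemma isGreatest_sSup (hK : K.Finite) (hne : K.Nonempty) (h : V → ℝ) :
    IsGreatest {c | ∃ u ∈ K, c = h u} (sSup {c | ∃ u ∈ K, c = h u}) := by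
  obtain ⟨k, hk, hmax⟩ := Set.exists_max_image K h hK hne
  have : IsGreatest {c | ∃ u ∈ K, c = h u} (h k) := by
    refine ⟨⟨k, hk, rfl⟩, ?_⟩
    rintro c ⟨u, hu, rfl⟩
    exact hmax u hu
  rwa [this.csSup_eq]

lemma isLeast_sInf (hK : K.Finite) (hne : K.Nonempty) (h : V → ℝ) :
    IsLeast {c | ∃ u ∈ K, c = h u} (sInf {c | ∃ u ∈ K, c = h u}) := by
  obtain ⟨k, hk, hmin⟩ := Set.exists_min_image K h hK hne
  have : IsLeast {c | ∃ u ∈ K, c = h u} (h k) := by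
    refine ⟨⟨k, hk, rfl⟩, ?_⟩
    rintro c ⟨u, hu, rfl⟩
    exact hmin u hu
  rwa [this.csInf_eq]

lemma Sop_of_mem {v : V} (hv : v ∈ K) : Sop d X Y K f v = f v := by
  simp [Sop, hv]

lemma isExtremal_Sop (hG : IsGraphBase w m d) (hP : SalamiPartition w m X Y K)
    (hf : Lip1On d K f) : IsExtremal d X Y K (Sop d X Y K f) := by
  have hne := hP.nonempty hG
  have hsep := fun x hx y hy => hP.exists_dist_add_le hG (x := x) (y := y) hx hy
  have hcases := hP.mem_cases
  obtain ⟨-, hXY, hXK, hYK, hK, -, -, -⟩ := hP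
  obtain ⟨-, -, -, -, -, -, -, ⟨-, -, hdsym, htri, -⟩, -⟩ := hG
  set g := Sop d X Y K f with hg
  have hgK : ∀ k ∈ K, g k = f k := fun k hk => Sop_of_mem hk
  have hgX : ∀ x ∈ X, IsGreatest {c | ∃ u ∈ K, c = f u - d x u} (g x) := by
    intro x hx
    have : g x = sSup {c | ∃ u ∈ K, c = f u - d x u} := by
      simp [hg, Sop, Set.disjoint_left.1 hXK hx, hx]
    rw [this]
    exact isGreatest_sSup hK hne fun u => f u - d x u
  have hgY : ∀ y ∈ Y, IsLeast {c | ∃ u ∈ K, c = f u + d y u} (g y) := by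
    intro y hy
    have : g y = sInf {c | ∃ u ∈ K, c = f u + d y u} := by
      simp [hg, Sop, Set.disjoint_left.1 hYK hy, Set.disjoint_right.1 hXY hy]
    rw [this]
    exact isLeast_sInf hK hne fun u => f u + d y u
  have hXle : ∀ x ∈ X, ∀ k ∈ K, f k - d x k ≤ g x := fun x hx k hk => (hgX x hx).2 ⟨k, hk, rfl⟩
  have hYle : ∀ y ∈ Y, ∀ k ∈ K, g y ≤ f k + d y k := fun y hy k hk => (hgY y hy).2 ⟨k, hk, rfl⟩
  refine ⟨fun u v => ?_, fun x hx => ?_, fun y hy => ?_⟩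
  · rcases hcases u with hu | hu | hu <;> rcases hcases v with hv | hv | hv
    · obtain ⟨k, hk, h⟩ := (hgX v hv).1
      linarith [hXle u hu k hk, htri u v k]
    · obtain ⟨k, hk, h⟩ := hsep u hu v hv
      linarith [hXle u hu k hk, hYle v hv k hk, hdsym k v]
    · linarith [hXle u hu v hv, hgK v hv]
    · obtain ⟨k, hk, h⟩ := (hgX v hv).1
      obtain ⟨l, hl, h'⟩ := (hgY u hu).1
      linarith [hf l hl k hk, htri l u k, htri u v k, hdsym l u]
    · obtain ⟨k, hk, h⟩ := (hgY u hu).1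
      linarith [hYle v hv k hk, htri v u k, hdsym u v]
    · obtain ⟨k, hk, h⟩ := (hgY u hu).1
      linarith [hgK v hv, hf k hk v hv, htri k u v, hdsym k u]
    · obtain ⟨k, hk, h⟩ := (hgX v hv).1
      linarith [hgK u hu, hf u hu k hk, htri u v k]
    · linarith [hYle v hv u hu, hgK u hu, hdsym u v]
    · rw [hgK u hu, hgK v hv]
      exact hf u hu v hv
  · obtain ⟨k, hk, h⟩ := (hgX x hx).1
    exact ⟨k, hk, by rw [hgK k hk]; linarith⟩
  · obtain ⟨k, hk, h⟩ := (hgY y hy).1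
    exact ⟨k, hk, by rw [hgK k hk]; linarith [hdsym k y]⟩

lemma IsExtremal.mem_calF (hG : IsGraphBase w m d) (hP : SalamiPartition w m X Y K)
    (hf : IsExtremal d X Y K f) : f ∈ calF d X Y K := by
  have hlip : Lip1On d K f := fun x _ y _ => hf.lip x y
  have hg := isExtremal_Sop hG hP hlip
  refine ⟨f, hlip, funext fun v => le_antisymm ?_ ?_⟩
  · exact hf.le_of_le_on hP hg (fun k hk => (Sop_of_mem hk).ge) v
  · exact hg.le_of_le_on hP hf (fun k hk => (Sop_of_mem hk).le) v

lemma isExtremal_of_mem_calF (hG : IsGraphBase w m d) (hP : SalamiPartition w m X Y K)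
    (hf : f ∈ calF d X Y K) : IsExtremal d X Y K f := by
  obtain ⟨g, hg, rfl⟩ := hf
  exact isExtremal_Sop hG hP hg

/-- Discrete Green formula: interior contributions cancel. -/
lemma sum_mul_lap_eq (hG : IsGraphBase w m d) (f : V → ℝ) {U T : Finset V} [DecidableEq V]
    (hUT : U ⊆ T) (hT : ∀ x ∈ U, ∀ y, 0 < w x y → y ∈ T) :
    ∑ x ∈ U, m x * lap w m f x = ∑ x ∈ U, ∑ y ∈ T \ U, w x y * (f y - f x) := by
  obtain ⟨-, hsym, hw, -, hm, -⟩ := hG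
  have h1 : ∀ x ∈ U, m x * lap w m f x =
      ∑ y ∈ T \ U, w x y * (f y - f x) + ∑ y ∈ U, w x y * (f y - f x) := by
    intro x hx
    rw [lap_eq_sum hw f (hT x hx), mul_inv_cancel_left₀ (hm x).ne', Finset.sum_sdiff hUT]
  rw [Finset.sum_congr rfl h1, Finset.sum_add_distrib, add_eq_left]
  have h2 : ∑ x ∈ U, ∑ y ∈ U, w x y * (f y - f x) =
      -∑ x ∈ U, ∑ y ∈ U, w x y * (f y - f x) := by
    conv_lhs => rw [Finset.sum_comm]
    simp only [← Finset.sum_neg_distrib]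
    refine Finset.sum_congr rfl fun x _ => Finset.sum_congr rfl fun y _ => ?_
    rw [hsym y x]
    ring
  linarith

/-- The flux through `K` bounds the volume of `X`, so `lap f` cannot be positive on `K`. -/
lemma IsExtremal.not_lap_pos (hG : IsGraphBase w m d) (hκ : NonnegCurv w m d)
    (hP : SalamiPartition w m X Y K) (hf : IsExtremal d X Y K f) :
    ¬ ∀ k ∈ K, 0 < lap w m f k := by
  classical
  intro hpos
  have hcases := hP.mem_cases
  have hKne := hP.nonempty hG
  obtain ⟨-, -, -, -, hK, hsep, hX, -⟩ := hP
  have hsum := fun U T => sum_mul_lap_eq hG f (U := U) (T := T)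
  obtain ⟨k₀, hk₀, hmin⟩ := Set.exists_min_image K (lap w m f) hK hKne
  have hlow : ∀ v, v ∈ X ∨ v ∈ K → lap w m f k₀ ≤ lap w m f v := by
    rintro v (hv | hv)
    · obtain ⟨k, hk, h⟩ := hf.left v hv
      exact (hmin k hk).trans (lap_le_lap hG hκ hf.lip v k h)
    · exact hmin v hv
  have hc := hpos k₀ hk₀
  set c := lap w m f k₀
  obtain ⟨-, hsym, hw, -, hm, hlf, -, ⟨hd0, hdpos, hdsym, -, -⟩, hball⟩ := hG
  have hd : ∀ x y, 0 ≤ d x y := fun x y => by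
    by_cases h : x = y
    · rw [h, hd0]
    · exact (hdpos x y h).le
  set C := ∑ x ∈ hK.toFinset, ∑ y ∈ hlf.nbrs x, w x y * d x y
  obtain ⟨F, hFX, hF⟩ := hX (C / c)
  obtain ⟨z, -, hz⟩ := Finset.exists_min_image (F ∪ hK.toFinset) f
    ⟨k₀, by simp [hk₀]⟩
  have hUfin : {v | (v ∈ X ∨ v ∈ K) ∧ f z ≤ f v}.Finite := by
    refine (hK.union (hK.biUnion fun k _ => hball k (f k - f z))).subset ?_
    rintro v ⟨hv | hv, hfv⟩
    · obtain ⟨k, hk, h⟩ := hf.left v hv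
      refine Or.inr (Set.mem_biUnion hk ?_)
      change d k v ≤ f k - f z
      rw [hdsym, ← h]
      linarith
    · exact Or.inl hv
  set U := hUfin.toFinset with hU
  have hmemU : ∀ v, v ∈ U ↔ (v ∈ X ∨ v ∈ K) ∧ f z ≤ f v := fun v => by
    rw [hU, Set.Finite.mem_toFinset]
    rfl
  set T := U ∪ U.biUnion hlf.nbrs with hTdef
  have hT : ∀ x ∈ U, ∀ y, 0 < w x y → y ∈ T := fun x hx y hxy =>
    Finset.mem_union_right _ (Finset.mem_biUnion.2 ⟨x, hx, by simpa [LocallyFinite.nbrs] using hxy⟩)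
  have hflux : ∑ x ∈ U, m x * lap w m f x ≤ C := by
    rw [hsum U T Finset.subset_union_left hT]
    have hinner : ∀ x ∈ U, ∑ y ∈ T \ U, w x y * (f y - f x) ≤
        if x ∈ K then ∑ y ∈ hlf.nbrs x, w x y * d x y else 0 := by
      intro x hx
      split_ifs with hxK
      · calc ∑ y ∈ T \ U, w x y * (f y - f x) ≤ ∑ y ∈ T \ U, w x y * d x y := by
              gcongr with y
              · exact hw x y
              · exact hf.lip x y
          _ ≤ ∑ y ∈ T, w x y * d x y :=
              Finset.sum_le_sum_of_subset_of_nonneg Finset.sdiff_subset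
                fun y _ _ => mul_nonneg (hw x y) (hd x y)
          _ = ∑ y ∈ hlf.nbrs x, w x y * d x y := by
              refine (Finset.sum_subset (fun y hy => hT x hx y ?_) fun y _ hy => ?_).symm
              · simpa [LocallyFinite.nbrs] using hy
              · have : w x y = 0 := le_antisymm
                  (by simpa [LocallyFinite.nbrs] using hy) (hw x y)
                simp [this]
      · refine Finset.sum_nonpos fun y hy => ?_
        obtain ⟨hxXK, hzx⟩ := (hmemU x).1 hx
        have hyU := (Finset.mem_sdiff.1 hy).2
        rw [hmemU, not_and] at hyU
        have hdown : y ∈ X ∨ y ∈ K → w x y * (f y - f x) ≤ 0 := fun h =>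
          mul_nonpos_of_nonneg_of_nonpos (hw x y) (by linarith [not_le.1 (hyU h)])
        rcases hcases y with h | h | h
        · exact hdown (Or.inl h)
        · simp [hsep x (hxXK.resolve_right hxK) y h]
        · exact hdown (Or.inr h)
    refine (Finset.sum_le_sum hinner).trans ?_
    rw [← Finset.sum_filter]
    refine Finset.sum_le_sum_of_subset_of_nonneg (fun x hx => ?_) fun x _ _ =>
      Finset.sum_nonneg fun y _ => mul_nonneg (hw x y) (hd x y)
    simpa using (Finset.mem_filter.1 hx).2
  have hvol : c * ∑ x ∈ F, m x ≤ ∑ x ∈ U, m x * lap w m f x := by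
    rw [Finset.mul_sum]
    calc ∑ x ∈ F, c * m x ≤ ∑ x ∈ U, c * m x := by
          refine Finset.sum_le_sum_of_subset_of_nonneg (fun x hx => ?_) fun x _ _ =>
            mul_nonneg hc.le (hm x).le
          exact (hmemU x).2 ⟨Or.inl (hFX hx), hz x (Finset.mem_union_left _ hx)⟩
      _ ≤ ∑ x ∈ U, m x * lap w m f x := by
          refine Finset.sum_le_sum fun x hx => ?_
          rw [mul_comm]
          exact mul_le_mul_of_nonneg_left (hlow x ((hmemU x).1 hx).1) (hm x).le
  rw [div_lt_iff₀ hc] at hF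
  linarith

/-- Raising `f` off the set where `lap f` attains the lower bound `c` shrinks that set. -/
lemma IsExtremal.exists_shrink (hG : IsGraphBase w m d) (hκ : NonnegCurv w m d)
    (hP : SalamiPartition w m X Y K) (hcut : CutConnected w K) (hf : IsExtremal d X Y K f)
    {c : ℝ} (hc : ∀ k ∈ K, c ≤ lap w m f k) (hex : ∃ k ∈ K, c < lap w m f k)
    (hne : ∃ k ∈ K, lap w m f k = c) :
    ∃ g, IsExtremal d X Y K g ∧ (∀ k ∈ K, c ≤ lap w m g k) ∧
      {k ∈ K | lap w m g k = c} ⊂ {k ∈ K | lap w m f k = c} := by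
  classical
  set A := {k ∈ K | lap w m f k = c} with hA
  have hgt : ∀ b ∈ K \ A, c < lap w m f b := fun b hb =>
    (hc b hb.1).lt_of_ne fun h => hb.2 ⟨hb.1, h.symm⟩
  have hK := hP.2.2.2.2.1
  obtain ⟨-, hsym, hw, -, hm, hlf, -, ⟨hd0, hdpos, hdsym, -, -⟩, -⟩ := id hG
  have hgap : ∀ a ∈ A, ∀ b ∈ K \ A, f b - f a < d a b := fun a ha b hb =>
    (hf.lip a b).lt_of_ne fun h =>
      ((hgt b hb).trans_le ((lap_le_lap hG hκ hf.lip a b h).trans_eq ha.2)).false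
  set D : V → ℝ := fun x => (m x)⁻¹ * ∑ y ∈ hlf.nbrs x, w x y
  have hsmall : ∀ s t : ℝ, 0 < t → ∀ᶠ ε in nhdsWithin (0 : ℝ) (Set.Ioi 0), ε * s < t := by
    intro s t ht
    have : Tendsto (fun ε : ℝ => ε * s) (nhds 0) (nhds (0 * s)) :=
      (continuous_id.mul continuous_const).tendsto 0
    rw [zero_mul] at this
    exact (this.eventually (gt_mem_nhds ht)).filter_mono nhdsWithin_le_nhds
  have hev1 : ∀ᶠ ε in nhdsWithin (0 : ℝ) (Set.Ioi 0),
      ∀ a ∈ A, ∀ b ∈ K \ A, ε * 1 < d a b - (f b - f a) :=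
    ((hK.subset (Set.sep_subset _ _)).eventually_all).2 fun a ha =>
      ((hK.subset Set.sdiff_subset).eventually_all).2 fun b hb =>
        hsmall _ _ (sub_pos.2 (hgap a ha b hb))
  have hev2 : ∀ᶠ ε in nhdsWithin (0 : ℝ) (Set.Ioi 0),
      ∀ b ∈ K \ A, ε * D b < lap w m f b - c :=
    ((hK.subset Set.sdiff_subset).eventually_all).2 fun b hb =>
      hsmall _ _ (sub_pos.2 (hgt b hb))
  obtain ⟨ε, ⟨h1, h2⟩, hε⟩ := ((hev1.and hev2).and self_mem_nhdsWithin).exists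
  have hε : 0 < ε := hε
  set h : V → ℝ := fun v => if v ∈ A then f v else f v + ε with hh
  have hlip : Lip1On d K h := by
    intro x hx y hy
    have := hf.lip x y
    simp only [hh]
    split_ifs with hxA hyA hyA
    · exact this
    · linarith
    · linarith [h1 x hyA y ⟨hy, hxA⟩]
    · linarith
  have hg := isExtremal_Sop hG hP hlip
  set g := Sop d X Y K h
  have hgA : ∀ a ∈ A, g a = f a := fun a ha => by
    rw [show g a = h a from Sop_of_mem ha.1]
    simp [hh, ha]
  have hgB : ∀ b ∈ K \ A, g b = f b + ε := fun b hb => by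
    rw [show g b = h b from Sop_of_mem hb.1]
    simp only [hh, if_neg hb.2]
  have hfg : ∀ v, f v ≤ g v := by
    refine hf.le_of_le_on hP hg fun k hk => ?_
    by_cases hkA : k ∈ A
    · exact (hgA k hkA).ge
    · rw [hgB k ⟨hk, hkA⟩]
      linarith
  have hlapA : ∀ a ∈ A, c ≤ lap w m g a := by
    intro a ha
    rw [← ha.2, lap_eq_sum_nbrs hw hlf, lap_eq_sum_nbrs hw hlf, hgA a ha]
    have := (inv_pos.2 (hm a)).le
    gcongr with y
    · exact hw a y
    · exact hfg y
  have hlapB : ∀ b ∈ K \ A, c < lap w m g b := by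
    intro b hb
    have hle : lap w m f b - ε * D b ≤ lap w m g b := by
      rw [lap_eq_sum_nbrs hw hlf, lap_eq_sum_nbrs hw hlf, hgB b hb]
      have hinv := (inv_pos.2 (hm b)).le
      have : (m b)⁻¹ * ∑ y ∈ hlf.nbrs b, w b y * (f y - f b) - ε * D b =
          (m b)⁻¹ * ∑ y ∈ hlf.nbrs b, w b y * (f y - (f b + ε)) := by
        simp only [D]
        rw [mul_left_comm ε, ← mul_sub, Finset.mul_sum, ← Finset.sum_sub_distrib]
        congr 1
        exact Finset.sum_congr rfl fun y _ => by ring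
      rw [this]
      gcongr with y
      · exact hw b y
      · exact hfg y
    linarith [h2 b hb]
  refine ⟨g, hg, fun k hk => ?_, ?_⟩
  · by_cases hkA : k ∈ A
    · exact hlapA k hkA
    · exact (hlapB k ⟨hk, hkA⟩).le
  rw [Set.ssubset_iff_of_subset]
  · obtain ⟨k, hk, hkc⟩ := hex
    obtain ⟨k', hk', hkc'⟩ := hne
    obtain ⟨a, ha, b, hb, hab⟩ := hcut A (Set.sep_subset _ _) ⟨k', hk', hkc'⟩ fun hAK => by
      have : k ∈ A := hAK ▸ hk
      exact hkc.ne' this.2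
    refine ⟨a, ha, fun hga => ?_⟩
    have : lap w m f a < lap w m g a := by
      rw [lap_eq_sum_nbrs hw hlf, lap_eq_sum_nbrs hw hlf, hgA a ha]
      refine mul_lt_mul_of_pos_left (Finset.sum_lt_sum (fun y _ => ?_)
        ⟨b, by simpa [LocallyFinite.nbrs] using hab, ?_⟩) (inv_pos.2 (hm a))
      · exact mul_le_mul_of_nonneg_left (by linarith [hfg y]) (hw a y)
      · exact mul_lt_mul_of_pos_left (by linarith [hgB b hb]) hab
    exact (this.trans_eq (hga.2.trans ha.2.symm)).false
  · rintro k ⟨hk, hkc⟩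
    by_contra hkA
    exact (hlapB k ⟨hk, hkA⟩).ne' hkc

lemma IsExtremal.exists_lap_gt (hG : IsGraphBase w m d) (hκ : NonnegCurv w m d)
    (hP : SalamiPartition w m X Y K) (hcut : CutConnected w K) (hf : IsExtremal d X Y K f)
    {c : ℝ} (hc : ∀ k ∈ K, c ≤ lap w m f k) (hex : ∃ k ∈ K, c < lap w m f k) :
    ∃ g, IsExtremal d X Y K g ∧ ∀ k ∈ K, c < lap w m g k := by
  have hK := hP.2.2.2.2.1
  induction hn : {k ∈ K | lap w m f k = c}.ncard using Nat.strong_induction_on generalizing f with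
  | _ n ih =>
    by_cases hne : ∃ k ∈ K, lap w m f k = c
    · obtain ⟨g, hg, hgc, hss⟩ := hf.exists_shrink hG hκ hP hcut hc hex hne
      refine ih _ (hn ▸ Set.ncard_lt_ncard hss (hK.subset (Set.sep_subset _ _))) hg hgc ?_ rfl
      obtain ⟨k, hk, hk'⟩ := Set.exists_of_ssubset hss
      exact ⟨k, hk.1, (hgc k hk.1).lt_of_ne fun h => hk' ⟨hk.1, h.symm⟩⟩
    · push Not at hne
      exact ⟨f, hf, fun k hk => (hc k hk).lt_of_ne (hne k hk).symm⟩

/-- `K` can be enlarged inside `X` to a finite connected set containing a given vertex. -/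
lemma SalamiPartition.exists_enlarge (hG : IsGraphBase w m d) (hP : SalamiPartition w m X Y K)
    (hcut : CutConnected w K) {x : V} (hx : x ∈ X) :
    ∃ K', K ⊆ K' ∧ x ∈ K' ∧ SalamiPartition w m (X \ K') Y K' ∧ CutConnected w K' := by
  obtain ⟨k, hk⟩ := hP.nonempty hG
  have hcases := hP.mem_cases
  obtain ⟨hu, hXY, hXK, hYK, hK, hsep, hX, hY⟩ := hP
  obtain ⟨-, hsym, -, -, hm, -, hconn, -⟩ := hG
  have key : ∀ x, x ∈ Y ∨ ∃ K', K ⊆ K' ∧ x ∈ K' ∧ K'.Finite ∧ Disjoint Y K' ∧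
      CutConnected w K' := by
    intro x
    induction hconn k x with
    | refl => exact Or.inr ⟨K, subset_rfl, hk, hK, hYK, hcut⟩
    | @tail u v _ huv ih =>
      rcases hcases v with hv | hv | hv
      · obtain hu | ⟨K', hKK', hu, hfin, hdisj, hcut'⟩ := ih
        · rw [hsym, hsep v hv u hu] at huv
          exact absurd huv (lt_irrefl _)
        · refine Or.inr ⟨insert v K', hKK'.trans (Set.subset_insert v K'), Set.mem_insert v K',
            hfin.insert v, ?_, hcut'.insert hsym hu huv⟩
          rw [Set.disjoint_insert_right]
          exact ⟨Set.disjoint_left.1 hXY hv, hdisj⟩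
      · exact Or.inl hv
      · exact Or.inr ⟨K, subset_rfl, hv, hK, hYK, hcut⟩
  obtain hxY | ⟨K', hKK', hxK', hfin, hdisj, hcut'⟩ := key x
  · exact absurd hxY (Set.disjoint_left.1 hXY hx)
  refine ⟨K', hKK', hxK', ⟨?_, hXY.mono_left Set.sdiff_subset, Set.disjoint_sdiff_left, hdisj, hfin,
    fun a ha b hb => hsep a ha.1 b hb, hX.diff hm hfin, hY⟩, hcut'⟩
  refine Set.eq_univ_of_forall fun v => ?_
  by_cases hv : v ∈ K'
  · exact Or.inr hv
  · rcases hcases v with h | h | h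
    · exact Or.inl (Or.inl ⟨h, hv⟩)
    · exact Or.inl (Or.inr h)
    · exact absurd (hKK' h) hv

lemma IsExtremal.lap_eq_zero_left (hG : IsGraphBase w m d) (hκ : NonnegCurv w m d)
    (hP : SalamiPartition w m X Y K) (hcut : CutConnected w K) (hf : IsExtremal d X Y K f)
    (h0 : ∀ k ∈ K, lap w m f k = 0) {x : V} (hx : x ∈ X) : lap w m f x = 0 := by
  have hnonneg : ∀ v, v ∉ Y → 0 ≤ lap w m f v := by
    intro v hvY
    rcases hP.mem_cases v with hv | hv | hv
    · obtain ⟨k, hk, h⟩ := hf.left v hv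
      exact (h0 k hk).ge.trans (lap_le_lap hG hκ hf.lip v k h)
    · exact absurd hv hvY
    · exact (h0 v hv).ge
  by_contra hne
  obtain ⟨K', hKK', hxK', hP', hcut'⟩ := hP.exists_enlarge hG hcut hx
  have hpos : 0 < lap w m f x :=
    (hnonneg x (Set.disjoint_left.1 hP.2.1 hx)).lt_of_ne (Ne.symm hne)
  obtain ⟨g, hg, hglap⟩ := (hf.mono Set.sdiff_subset hKK').exists_lap_gt hG hκ hP' hcut'
    (fun k hk => hnonneg k (Set.disjoint_right.1 hP'.2.2.2.1 hk)) ⟨x, hxK', hpos⟩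
  exact hg.not_lap_pos hG hκ hP' hglap

lemma IsExtremal.lap_eq_zero (hG : IsGraphBase w m d) (hκ : NonnegCurv w m d)
    (hP : SalamiPartition w m X Y K) (hcut : CutConnected w K) (hf : IsExtremal d X Y K f)
    (h0 : ∀ k ∈ K, lap w m f k = 0) (x : V) : lap w m f x = 0 := by
  rcases hP.mem_cases x with hx | hx | hx
  · exact hf.lap_eq_zero_left hG hκ hP hcut h0 hx
  · have := (hf.neg hG.2.2.2.2.2.2.2.1.2.2.1).lap_eq_zero_left hG hκ (hP.symm hG) hcut
      (fun k hk => by rw [lap_neg, h0 k hk, neg_zero]) hx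
    rwa [lap_neg, neg_eq_zero] at this
  · exact h0 x hx

lemma isCompact_setOf_isExtremal (hG : IsGraphBase w m d) (hK : K.Finite) (k₀ : V) :
    IsCompact {f : V → ℝ | IsExtremal d X Y K f ∧ f k₀ = 0} := by
  have hdsym := hG.2.2.2.2.2.2.2.1.2.2.1
  have hclosed : IsClosed {f : V → ℝ | IsExtremal d X Y K f ∧ f k₀ = 0} := by
    have : {f : V → ℝ | IsExtremal d X Y K f ∧ f k₀ = 0} =
        (⋂ x, ⋂ y, {f : V → ℝ | f y - f x ≤ d x y}) ∩
        ((⋂ x ∈ X, ⋃ k ∈ K, {f : V → ℝ | f k - f x = d x k}) ∩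
        ((⋂ y ∈ Y, ⋃ k ∈ K, {f : V → ℝ | f y - f k = d k y}) ∩ {f : V → ℝ | f k₀ = 0})) := by
      ext f
      simp only [Set.mem_ofPred_eq, Set.mem_inter_iff, Set.mem_iInter, Set.mem_iUnion, exists_prop]
      exact ⟨fun h => ⟨h.1.lip, h.1.left, h.1.right, h.2⟩,
        fun h => ⟨⟨h.1, h.2.1, h.2.2.1⟩, h.2.2.2⟩⟩
    rw [this]
    refine IsClosed.inter ?_ (IsClosed.inter ?_ (IsClosed.inter ?_ ?_))
    · exact isClosed_iInter fun x => isClosed_iInter fun y =>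
        isClosed_le (by fun_prop) (by fun_prop)
    · exact isClosed_biInter fun x _ => hK.isClosed_biUnion fun k _ =>
        isClosed_eq (by fun_prop) (by fun_prop)
    · exact isClosed_biInter fun x _ => hK.isClosed_biUnion fun k _ =>
        isClosed_eq (by fun_prop) (by fun_prop)
    · exact isClosed_eq (by fun_prop) (by fun_prop)
  refine (isCompact_univ_pi fun v => isCompact_Icc (a := -d k₀ v) (b := d k₀ v)).of_isClosed_subset
    hclosed ?_
  rintro f ⟨hf, h0⟩ v -
  constructor <;> linarith [hf.lip k₀ v, hf.lip v k₀, hdsym v k₀]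

lemma exists_isExtremal_lap_eq_zero (hG : IsGraphBase w m d) (hκ : NonnegCurv w m d)
    (hP : SalamiPartition w m X Y K) (hcut : CutConnected w K) :
    ∃ f, IsExtremal d X Y K f ∧ ∀ k ∈ K, lap w m f k = 0 := by
  obtain ⟨k₀, hk₀⟩ := hP.nonempty hG
  have hK := hP.2.2.2.2.1
  obtain ⟨-, -, hw, -, hm, hlf, -, ⟨hd0, hdpos, -, -, -⟩, -⟩ := id hG
  have hKne : hK.toFinset.Nonempty := ⟨k₀, by simpa using hk₀⟩
  have hcont : Continuous fun f : V → ℝ => hK.toFinset.inf' hKne fun k => lap w m f k := by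
    refine Continuous.finset_inf'_apply hKne fun k _ => ?_
    simp only [lap_eq_sum_nbrs hw hlf]
    fun_prop
  have hzero : Lip1On d K (0 : V → ℝ) := by
    intro x _ y _
    by_cases h : x = y
    · simp [h, hd0]
    · simpa using (hdpos x y h).le
  obtain ⟨f, ⟨hf, hf0⟩, hmax⟩ :=
    (isCompact_setOf_isExtremal (X := X) (Y := Y) hG hK k₀).exists_isMaxOn
      ⟨Sop d X Y K 0, isExtremal_Sop hG hP hzero, by simp [Sop_of_mem hk₀]⟩ hcont.continuousOn
  set c := hK.toFinset.inf' hKne fun k => lap w m f k with hcdef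
  have hc : ∀ k ∈ K, c ≤ lap w m f k := fun k hk =>
    Finset.inf'_le _ (by simpa using hk)
  have hconst : ∀ k ∈ K, lap w m f k = c := by
    by_contra! hcon
    obtain ⟨k, hk, hne⟩ := hcon
    obtain ⟨g, hg, hgc⟩ := hf.exists_lap_gt hG hκ hP hcut hc ⟨k, hk, (hc k hk).lt_of_ne hne.symm⟩
    have hle : (hK.toFinset.inf' hKne fun k => lap w m (fun v => g v - g k₀) k) ≤ c :=
      hmax ⟨hg.sub_const (g k₀), by simp⟩
    refine hle.not_gt ((Finset.lt_inf'_iff hKne).2 fun k hk => ?_)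
    rw [lap_sub_const]
    exact hgc k (by simpa using hk)
  refine ⟨f, hf, fun k hk => ?_⟩
  rw [hconst k hk]
  refine le_antisymm (le_of_not_gt fun h => ?_) (le_of_not_gt fun h => ?_)
  · exact hf.not_lap_pos hG hκ hP fun k hk => by rwa [hconst k hk]
  · refine (hf.neg hG.2.2.2.2.2.2.2.1.2.2.1).not_lap_pos hG hκ (hP.symm hG) fun k hk => ?_
    rw [lap_neg, hconst k hk]
    linarith

end Graph

/-- **Lemma (Harmonic everywhere).** On a salami with connected salami partition
`P = (X,Y,K)`: any `f ∈ ℱ(P)` with `Δf = 0` on `K` is harmonic on all of `V`;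
in particular `ℋ(P)` is non-empty. -/
theorem harmonic_everywhere {V : Type*} (w : V → V → ℝ) (m : V → ℝ)
    (d : V → V → ℝ) (hS : IsSalami w m d) (X Y K : Set V)
    (hP : ConnectedSalamiPartition w m X Y K) :
    (∀ f ∈ calF d X Y K, (∀ x ∈ K, lap w m f x = 0) → ∀ x, lap w m f x = 0) ∧
    (calH w m d X Y K).Nonempty := by
  obtain ⟨hG, hκ, -⟩ := hS
  obtain ⟨hP, hconn⟩ := hP
  have hcut := hconn.cutConnected
  refine ⟨fun f hf h0 => (isExtremal_of_mem_calF hG hP hf).lap_eq_zero hG hκ hP hcut h0, ?_⟩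
  obtain ⟨f, hf, h0⟩ := exists_isExtremal_lap_eq_zero hG hκ hP hcut
  exact ⟨f, hf.mem_calF hG hP, hf.lap_eq_zero hG hκ hP hcut h0⟩

end SalamiPaper
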